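/- arXiv:1306.3638 — 2 statements merged into one kernel-verified Lean document; each statement's English description precedes it below -/
import Mathlib

section
/- Let x, z ∈ C²(ℝ, ℝⁿ) satisfy ẍ(t) = F(x(t)) and z̈(t) = F^l(z(t)) for all t ∈ ℝ, and suppose there exists v ∈ ℝⁿ, v ≠ 0, such that ẋ(t) → v and ż(t) → v as t → +∞. Then sup_{t ≥ 0} |x(t) − z(t)| < ∞. -/
open MeasureTheory Real Filter Set Topology RealInnerProductSpace

noncomputable section

namespace Paper

/-- ℝⁿ -/
abbrev Euc (n : ℕ) : Type := EuclideanSpace ℝ (Fin n)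

variable {n : ℕ}

/-- the norm `sup_{t ≤ 0} ‖f t‖ + sup_{t ≥ 0} ‖f t‖/(1+t)` on the space `M_r`. -/
def Mnorm (f : ℝ → Euc n) : ℝ :=
  sSup ((fun t => ‖f t‖) '' Iic 0) + sSup ((fun t => ‖f t‖ / (1 + t)) '' Ici 0)

/-- membership in the complete metric space `M_r`. -/
def MemM (r : ℝ) (f : ℝ → Euc n) : Prop :=
  Continuous f ∧ BddAbove ((fun t => ‖f t‖) '' Iic 0) ∧
    BddAbove ((fun t => ‖f t‖ / (1 + t)) '' Ici 0) ∧ Mnorm f ≤ r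

/-- the long range decay conditions on `V^l`. -/
def LongRange (α βl0 βl1 βl2 : ℝ) (Vl : Euc n → ℝ) : Prop :=
  ContDiff ℝ 2 Vl ∧
    (∀ x, |Vl x| ≤ βl0 * (1 + ‖x‖) ^ (-α)) ∧
    (∀ x, ‖gradient Vl x‖ ≤ βl1 * (1 + ‖x‖) ^ (-(α + 1))) ∧
    (∀ x, ‖iteratedFDeriv ℝ 2 Vl x‖ ≤ βl2 * (1 + ‖x‖) ^ (-(α + 2)))

/-- the short range decay conditions on `V^s`. -/
def ShortRange (α βs1 βs2 βs3 : ℝ) (Vs : Euc n → ℝ) : Prop :=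
  ContDiff ℝ 2 Vs ∧
    (∀ x, |Vs x| ≤ βs1 * (1 + ‖x‖) ^ (-(α + 1))) ∧
    (∀ x, ‖gradient Vs x‖ ≤ βs2 * (1 + ‖x‖) ^ (-(α + 2))) ∧
    (∀ x, ‖iteratedFDeriv ℝ 2 Vs x‖ ≤ βs3 * (1 + ‖x‖) ^ (-(α + 3)))

/-- `z` is a C² solution of `z'' = Fl ∘ z` with `z 0 = x0`, `z' → w` along the filter `l`
(`atBot` for `z_-`, `atTop` for `z_+`), satisfying the growth bound `‖z t - x0 - t w‖ ≤ C |t|`. -/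
def IsFreeSol (Fl : Euc n → Euc n) (x0 w : Euc n) (l : Filter ℝ) (C : ℝ)
    (z : ℝ → Euc n) : Prop :=
  ContDiff ℝ 2 z ∧ (∀ t, deriv (deriv z) t = Fl (z t)) ∧ z 0 = x0 ∧
    Tendsto (fun t => deriv z t) l (𝓝 w) ∧ ∀ t, ‖z t - x0 - t • w‖ ≤ C * |t|

/-- the map `A` (or `𝒜` when `xm = 0` and `zm` already contains the base point). -/
def Aop (Fl F : Euc n → Euc n) (zm : ℝ → Euc n) (xm : Euc n)
    (f : ℝ → Euc n) (t : ℝ) : Euc n :=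
  ∫ σ in Iic t, ∫ τ in Iic σ, (F (zm τ + xm + f τ) - Fl (zm τ))

/-- the vector `l(v_-,x_-,y_-)`. -/
def lInt (Fl Fs F : Euc n → Euc n) (zm : ℝ → Euc n) (xm : Euc n) (ym : ℝ → Euc n) : Euc n :=
  (∫ σ in Iic (0:ℝ), ∫ τ in Iic σ, (F (zm τ + xm + ym τ) - Fl (zm τ))) -
    ∫ σ in Ici (0:ℝ), ∫ τ in Ici σ, Fs (zm τ + xm + ym τ)

/-- the vector `l₁(v_-,x_-)`. -/
def l1Int (Fl : Euc n → Euc n) (zp : ℝ → Euc n) (xm : Euc n) : Euc n :=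
  -∫ σ in Ici (0:ℝ), ∫ τ in Ici σ, (Fl (zp τ + xm) - Fl (zp τ))

/-- the vector `l₂(v_-,x_-,y_-)`. -/
def l2Int (Fl : Euc n → Euc n) (zm zp : ℝ → Euc n) (xm : Euc n) (ym : ℝ → Euc n) : Euc n :=
  -∫ σ in Ici (0:ℝ), ∫ τ in Ici σ, (Fl (zm τ + xm + ym τ) - Fl (zp τ + xm))

/-- the function `y_+`. -/
def yplusInt (Fl F : Euc n → Euc n) (zm zp : ℝ → Euc n) (xm : Euc n) (ym : ℝ → Euc n)
    (t : ℝ) : Euc n :=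
  ∫ σ in Ici t, ∫ τ in Ici σ, (F (zm τ + xm + ym τ) - Fl (zp τ))

/-- the vector `W(v_-,x_-)`. -/
def Wvec (Fl : Euc n → Euc n) (zm zp : ℝ → Euc n) (xm : Euc n) : Euc n :=
  (∫ σ in Iic (0:ℝ), ∫ τ in Iic σ, (Fl (zm τ + xm) - Fl (zm τ))) -
    ∫ σ in Ici (0:ℝ), ∫ τ in Ici σ, (Fl (zp τ + xm) - Fl (zp τ))

/-- the map `𝒢_{v_-,x_-}`; here `zm = z_-(v_-,x_-,·)` contains the base point `x_-`
and `zp h = z_+(ã, x_- + h, ·)`. -/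
def Gmap (Fl Fs F : Euc n → Euc n) (zm : ℝ → Euc n) (zp : Euc n → ℝ → Euc n)
    (ym : ℝ → Euc n) (h : Euc n) : Euc n :=
  lInt Fl Fs F zm 0 ym -
    ∫ σ in Ici (0:ℝ), ∫ τ in Ici σ, (Fl (zm τ + ym τ) - Fl (zp h τ))

/-- the vector `W̃(v_-,x_-)`; here `zp0 = z_+(ã, x_-, ·)`. -/
def Wtilde (Fl : Euc n → Euc n) (zm zp0 : ℝ → Euc n) : Euc n :=
  (∫ τ in Iic (0:ℝ), Fl (zm τ)) + ∫ τ in Ici (0:ℝ), Fl (zp0 τ)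

section SecondOrder

variable {E : Type*} [NormedAddCommGroup E] [NormedSpace ℝ E]

/-- A curve whose velocity tends to `v` stays within sublinear distance of `s ↦ s • v`. -/
lemma eventually_norm_sub_smul_le {x x' : ℝ → E} {v : E} (hx : ∀ s, HasDerivAt x (x' s) s)
    (hlim : Tendsto x' atTop (𝓝 v)) {ε : ℝ} (hε : 0 < ε) :
    ∀ᶠ s in atTop, ‖x s - s • v‖ ≤ ε * s := by
  have h1 : ∀ᶠ s in atTop, ‖x' s - v‖ < ε / 2 := by
    have := (Metric.tendsto_nhds.1 hlim) (ε / 2) (by positivity)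
    simpa only [dist_eq_norm] using this
  obtain ⟨T, hT⟩ := eventually_atTop.1 (h1.and (eventually_ge_atTop (0 : ℝ)))
  have hT0 : 0 ≤ T := (hT T le_rfl).2
  filter_upwards [eventually_ge_atTop T,
    eventually_ge_atTop (2 / ε * ‖x T - T • v‖)] with s hs hs2
  have hd : ∀ r, HasDerivAt (fun r => x r - r • v) (x' r - v) r := fun r => by
    have h := (hx r).fun_sub ((hasDerivAt_id r).smul_const v)
    rwa [one_smul] at h
  have h2 : ‖(x s - s • v) - (x T - T • v)‖ ≤ ε / 2 * ‖s - T‖ :=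
    (convex_Icc T s).norm_image_sub_le_of_norm_hasDerivWithin_le
      (fun r _ => (hd r).hasDerivWithinAt) (fun r hr => (hT r hr.1).1.le)
      (left_mem_Icc.2 hs) (right_mem_Icc.2 hs)
  rw [Real.norm_of_nonneg (sub_nonneg.2 hs)] at h2
  have h3 : ‖x T - T • v‖ ≤ ε / 2 * s := by
    rw [div_mul_eq_mul_div, div_le_iff₀ hε] at hs2
    linarith
  have h4 := norm_le_norm_add_norm_sub' (x s - s • v) (x T - T • v)
  nlinarith

lemma hasDerivAt_neg_mul_rpow_neg {p : ℝ} (hp : 0 < p) (c : ℝ) {s : ℝ} (hs : 0 < s) :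
    HasDerivAt (fun r : ℝ => -(c / p) * r ^ (-p)) (c * s ^ (-(p + 1))) s := by
  refine ((Real.hasDerivAt_rpow_const (p := -p) (Or.inl hs.ne')).const_mul (-(c / p))).congr_deriv ?_
  rw [show -p - 1 = -(p + 1) by ring]
  field_simp

lemma norm_sub_le_of_norm_deriv_le {f f' : ℝ → E} {B B' : ℝ → ℝ} {a b : ℝ} (hab : a ≤ b)
    (hf : ∀ s, HasDerivAt f (f' s) s) (hB : ∀ s ∈ Icc a b, HasDerivAt B (B' s) s)
    (hle : ∀ s ∈ Icc a b, ‖f' s‖ ≤ B' s) : ‖f b - f a‖ ≤ B b - B a := by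
  refine image_norm_le_of_norm_deriv_right_le_deriv_boundary' (f := fun s => f s - f a)
    (f' := f') (a := a) (b := b) (B := fun s => B s - B a) (B' := B') ?_ ?_ ?_ ?_ ?_ ?_
    (right_mem_Icc.2 hab)
  · exact fun s _ => ((hf s).sub_const _).continuousAt.continuousWithinAt
  · exact fun s _ => ((hf s).sub_const _).hasDerivWithinAt
  · simp
  · exact fun s hs => ((hB s hs).sub_const _).continuousAt.continuousWithinAt
  · exact fun s hs => ((hB s (Ico_subset_Icc_self hs)).sub_const _).hasDerivWithinAt
  · exact fun s hs => hle s (Ico_subset_Icc_self hs)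

variable {w w' w'' : ℝ → E} {α C T : ℝ}

/-- If the velocity vanishes at infinity and the acceleration is `O(s ^ (-(α + 2)) (1 + ‖w‖))`,
then the velocity is `O(t ^ (-(α + 1)) (1 + ‖w‖))`. -/
lemma norm_deriv_le_of_norm_deriv2_le (hw : ∀ s, HasDerivAt w (w' s) s)
    (hw' : ∀ s, HasDerivAt w' (w'' s) s) (hlim : Tendsto w' atTop (𝓝 0)) (hα : 0 < α)
    (hC : 0 < C) (hT : 0 < T)
    (hacc : ∀ s, T ≤ s → ‖w'' s‖ ≤ C * s ^ (-(α + 2)) * (1 + ‖w s‖))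
    (hsmall : C / α * T ^ (-α) ≤ 1 / 2) {t : ℝ} (ht : T ≤ t) :
    ‖w' t‖ ≤ 2 * C * t ^ (-(α + 1)) * (1 + ‖w t‖) := by
  have ht0 : 0 < t := hT.trans_le ht
  have hbdd : BddAbove ((fun s => ‖w' s‖) '' Ici t) := by
    obtain ⟨R, hR⟩ := eventually_atTop.1
      ((tendsto_order.1 hlim.norm).2 1 (by simp))
    have hc : Continuous fun s => ‖w' s‖ :=
      (continuous_iff_continuousAt.2 fun s => (hw' s).continuousAt).norm
    obtain ⟨M, hM⟩ := (isCompact_Icc (a := t) (b := R)).bddAbove_image hc.continuousOn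
    refine ⟨max M 1, ?_⟩
    rintro _ ⟨s, hs, rfl⟩
    rcases le_total s R with h | h
    · exact le_max_of_le_left (hM ⟨s, ⟨hs, h⟩, rfl⟩)
    · exact le_max_of_le_right (hR s h).le
  set P := sSup ((fun s => ‖w' s‖) '' Ici t) with hP
  have hPle : ∀ s, t ≤ s → ‖w' s‖ ≤ P := fun s hs => le_csSup hbdd ⟨s, hs, rfl⟩
  have hP0 : 0 ≤ P := (norm_nonneg _).trans (hPle t le_rfl)
  have hpos : ∀ s, t ≤ s → ‖w s‖ ≤ ‖w t‖ + P * s := fun s hs => by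
    have h2 : ‖w s - w t‖ ≤ P * ‖s - t‖ :=
      (convex_Icc t s).norm_image_sub_le_of_norm_hasDerivWithin_le
        (fun r _ => (hw r).hasDerivWithinAt) (fun r hr => hPle r hr.1)
        (left_mem_Icc.2 hs) (right_mem_Icc.2 hs)
    rw [Real.norm_of_nonneg (sub_nonneg.2 hs)] at h2
    have := norm_le_norm_add_norm_sub' (w s) (w t)
    nlinarith
  set D := C * (1 + ‖w t‖) with hD
  have hD0 : 0 < D := by positivity
  set B : ℝ → ℝ := fun s => -(D / (α + 1)) * s ^ (-(α + 1)) + -(C * P / α) * s ^ (-α) with hB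
  have hBle : ∀ s, t ≤ s → B s ≤ 0 := fun s hs => by
    have hs0 : 0 < s := ht0.trans_le hs
    have h1 : 0 ≤ D / (α + 1) * s ^ (-(α + 1)) := by positivity
    have h2 : 0 ≤ C * P / α * s ^ (-α) := by positivity
    simp only [hB]
    linarith
  have hBd : ∀ s, t ≤ s →
      HasDerivAt B (D * s ^ (-(α + 1 + 1)) + C * P * s ^ (-(α + 1))) s := fun s hs =>
    (hasDerivAt_neg_mul_rpow_neg (by positivity) D (ht0.trans_le hs)).add
      (hasDerivAt_neg_mul_rpow_neg hα (C * P) (ht0.trans_le hs))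
  have hw2 : ∀ s, t ≤ s →
      ‖w'' s‖ ≤ D * s ^ (-(α + 1 + 1)) + C * P * s ^ (-(α + 1)) := fun s hs => by
    have hs0 : 0 < s := ht0.trans_le hs
    have hsp : s ^ (-(α + 1)) = s ^ (-(α + 2)) * s := by
      rw [← Real.rpow_add_one hs0.ne']
      ring_nf
    calc ‖w'' s‖ ≤ C * s ^ (-(α + 2)) * (1 + ‖w s‖) := hacc s (ht.trans hs)
      _ ≤ C * s ^ (-(α + 2)) * (1 + (‖w t‖ + P * s)) := by
        gcongr
        exact hpos s hs
      _ = _ := by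
        rw [hsp, hD, show α + 1 + 1 = α + 2 by ring]
        ring
  have hbound : ∀ s, t ≤ s → ‖w' s‖ ≤ -B t := fun s hs => by
    have hlim' : Tendsto (fun r => ‖w' r - w' s‖) atTop (𝓝 ‖w' s‖) := by
      simpa using (hlim.sub_const (w' s)).norm
    refine le_of_tendsto hlim' ?_
    filter_upwards [eventually_ge_atTop s] with r hr
    have h1 := norm_sub_le_of_norm_deriv_le hr hw' (fun q hq => hBd q (hs.trans hq.1))
      (fun q hq => hw2 q (hs.trans hq.1))
    have hmono : B t ≤ B s := by
      have h2 := norm_sub_le_of_norm_deriv_le hs hw' (fun q hq => hBd q hq.1)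
        (fun q hq => hw2 q hq.1)
      linarith [norm_nonneg (w' s - w' t)]
    linarith [hBle r (hs.trans hr)]
  have hPB : P ≤ -B t := csSup_le (nonempty_Ici.image _) (by
    rintro _ ⟨s, hs, rfl⟩
    exact hbound s hs)
  have h1 : C * P / α * t ^ (-α) ≤ P / 2 := by
    have : t ^ (-α) ≤ T ^ (-α) := Real.rpow_le_rpow_of_nonpos hT ht (by linarith)
    calc C * P / α * t ^ (-α) = P * (C / α * t ^ (-α)) := by ring
      _ ≤ P * (C / α * T ^ (-α)) := by gcongr
      _ ≤ P * (1 / 2) := by gcongr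
      _ = P / 2 := by ring
  have h2 : D / (α + 1) * t ^ (-(α + 1)) ≤ D * t ^ (-(α + 1)) := by
    gcongr
    exact div_le_self hD0.le (by linarith)
  have h3 : P ≤ 2 * (D * t ^ (-(α + 1))) := by
    simp only [hB] at hPB
    linarith
  calc ‖w' t‖ ≤ P := hPle t le_rfl
    _ ≤ _ := h3
    _ = _ := by rw [hD]; ring

lemma bddAbove_norm_of_norm_deriv2_le (hw : ∀ s, HasDerivAt w (w' s) s)
    (hw' : ∀ s, HasDerivAt w' (w'' s) s) (hlim : Tendsto w' atTop (𝓝 0)) (hα : 0 < α)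
    (hC : 0 < C) (hacc : ∀ᶠ s in atTop, ‖w'' s‖ ≤ C * s ^ (-(α + 2)) * (1 + ‖w s‖)) (a : ℝ) :
    BddAbove ((fun t => ‖w t‖) '' Ici a) := by
  have hsm : ∀ᶠ s : ℝ in atTop, C / α * s ^ (-α) < 1 / 4 := by
    have := (tendsto_rpow_neg_atTop hα).const_mul (C / α)
    rw [mul_zero] at this
    exact (tendsto_order.1 this).2 _ (by norm_num)
  obtain ⟨T₀, hT₀⟩ := eventually_atTop.1 hacc
  obtain ⟨T, ⟨hTs, hTT⟩, hT⟩ :=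
    ((hsm.and (eventually_ge_atTop T₀)).and (eventually_gt_atTop 0)).exists
  have hcont : Continuous fun s => ‖w s‖ :=
    (continuous_iff_continuousAt.2 fun s => (hw s).continuousAt).norm
  have hvel : ∀ t, T ≤ t → ‖w' t‖ ≤ 2 * C * t ^ (-(α + 1)) * (1 + ‖w t‖) := fun t ht =>
    norm_deriv_le_of_norm_deriv2_le hw hw' hlim hα hC hT (fun s hs => hT₀ s (hTT.trans hs))
      (by linarith) ht
  have hlate : ∀ R, T ≤ R → ‖w R‖ ≤ 2 * ‖w T‖ + 1 := fun R hR => by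
    obtain ⟨m, hm, hmax⟩ := (isCompact_Icc (a := T) (b := R)).exists_isMaxOn
      (nonempty_Icc.2 hR) hcont.continuousOn
    have hle : ∀ s ∈ Icc T R, ‖w s‖ ≤ ‖w m‖ := fun s hs => hmax hs
    have h1 := norm_sub_le_of_norm_deriv_le hm.1 hw
      (fun s hs => hasDerivAt_neg_mul_rpow_neg hα (2 * C * (1 + ‖w m‖)) (hT.trans_le hs.1))
      (fun s hs => (hvel s hs.1).trans (by
        have hs0 : 0 < s := hT.trans_le hs.1
        have := hle s ⟨hs.1, hs.2.trans hm.2⟩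
        calc 2 * C * s ^ (-(α + 1)) * (1 + ‖w s‖)
            ≤ 2 * C * s ^ (-(α + 1)) * (1 + ‖w m‖) := by gcongr
          _ = _ := by ring))
    have hm0 : 0 < m := hT.trans_le hm.1
    have h2 : 0 ≤ 2 * C * (1 + ‖w m‖) / α * m ^ (-α) := by positivity
    have h3 : 2 * C * (1 + ‖w m‖) / α * T ^ (-α) ≤ (1 + ‖w m‖) / 2 := by
      calc 2 * C * (1 + ‖w m‖) / α * T ^ (-α)
          = 2 * (1 + ‖w m‖) * (C / α * T ^ (-α)) := by ring
        _ ≤ 2 * (1 + ‖w m‖) * (1 / 4) := by gcongr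
        _ = _ := by ring
    have h4 := norm_le_norm_add_norm_sub' (w m) (w T)
    have h5 := hle R (right_mem_Icc.2 hR)
    linarith
  obtain ⟨M, hM⟩ := (isCompact_Icc (a := a) (b := T)).bddAbove_image hcont.continuousOn
  refine ⟨max M (2 * ‖w T‖ + 1), ?_⟩
  rintro _ ⟨s, hs, rfl⟩
  rcases le_total s T with h | h
  · exact le_max_of_le_left (hM ⟨s, ⟨hs, h⟩, rfl⟩)
  · exact le_max_of_le_right (hlate s h)

end SecondOrder

lemma norm_gradient_sub_le {V : Euc n → ℝ} (hV : ContDiff ℝ 2 V) {S : Set (Euc n)}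
    (hS : Convex ℝ S) {K : ℝ} (hK : ∀ y ∈ S, ‖iteratedFDeriv ℝ 2 V y‖ ≤ K) {a b : Euc n}
    (ha : a ∈ S) (hb : b ∈ S) : ‖gradient V b - gradient V a‖ ≤ K * ‖b - a‖ := by
  have h1 : ‖gradient V b - gradient V a‖ = ‖fderiv ℝ V b - fderiv ℝ V a‖ := by
    simp only [gradient, ← map_sub, LinearIsometryEquiv.norm_map]
  rw [h1]
  have hd : Differentiable ℝ (fderiv ℝ V) :=
    (hV.fderiv_right (m := 1) (by norm_num)).differentiable (by norm_num)
  refine hS.norm_image_sub_le_of_norm_fderiv_le (fun y _ => hd y) (fun y hy => ?_) ha hb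
  have h2 : ‖iteratedFDeriv ℝ 2 V y‖ = ‖fderiv ℝ (fderiv ℝ V) y‖ := by
    rw [← norm_iteratedFDeriv_fderiv, ← norm_iteratedFDeriv_fderiv, norm_iteratedFDeriv_zero]
  exact h2 ▸ hK y hy

lemma rpow_neg_one_add_norm_le {y v : Euc n} {s p : ℝ} (hp : 0 < p) (hs : 0 < s) (hv : v ≠ 0)
    (hy : ‖y - s • v‖ ≤ ‖v‖ / 2 * s) :
    (1 + ‖y‖) ^ (-p) ≤ (‖v‖ / 2) ^ (-p) * s ^ (-p) := by
  have hv0 : 0 < ‖v‖ := norm_pos_iff.2 hv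
  rw [← Real.mul_rpow (by positivity) hs.le]
  refine Real.rpow_le_rpow_of_nonpos (by positivity) ?_ (by linarith)
  have h1 : ‖s • v‖ = s * ‖v‖ := by rw [norm_smul, Real.norm_of_nonneg hs.le]
  rw [norm_sub_rev] at hy
  have h4 := norm_sub_norm_le (s • v) y
  nlinarith

theorem statement_1
    (n : ℕ) (hn : 2 ≤ n) (α : ℝ) (hα0 : 0 < α) (hα1 : α ≤ 1)
    (Vl Vs : Euc n → ℝ) (βl0 βl1 βl2 βs1 βs2 βs3 : ℝ)
    (hβl0 : 0 < βl0) (hβl1 : 0 < βl1) (hβl2 : 0 < βl2)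
    (hβs1 : 0 < βs1) (hβs2 : 0 < βs2) (hβs3 : 0 < βs3)
    (hVl : LongRange α βl0 βl1 βl2 Vl) (hVs : ShortRange α βs1 βs2 βs3 Vs)
    (Fl Fs F : Euc n → Euc n)
    (hFl : ∀ y, Fl y = -gradient Vl y) (hFs : ∀ y, Fs y = -gradient Vs y)
    (hF : ∀ y, F y = Fl y + Fs y)
    (x z : ℝ → Euc n)
    (hx2 : ContDiff ℝ 2 x) (hxeq : ∀ t, deriv (deriv x) t = F (x t))
    (hz2 : ContDiff ℝ 2 z) (hzeq : ∀ t, deriv (deriv z) t = Fl (z t))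
    (v : Euc n) (hv : v ≠ 0)
    (hxlim : Tendsto (fun t => deriv x t) atTop (𝓝 v))
    (hzlim : Tendsto (fun t => deriv z t) atTop (𝓝 v)) :
    BddAbove ((fun t => ‖x t - z t‖) '' Ici 0) := by
  have hd1 : ∀ {f : ℝ → Euc n}, ContDiff ℝ 2 f → ∀ s, HasDerivAt f (deriv f s) s :=
    fun hf s => (hf.differentiable (by norm_num) s).hasDerivAt
  have hd2 : ∀ {f : ℝ → Euc n}, ContDiff ℝ 2 f →
      ∀ s, HasDerivAt (deriv f) (deriv (deriv f) s) s := fun hf s =>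
    (((contDiff_succ_iff_deriv (n := 1)).1 hf).2.2.differentiable (by norm_num) s).hasDerivAt
  have hv0 : 0 < ‖v‖ := norm_pos_iff.2 hv
  set c := (‖v‖ / 2) ^ (-(α + 2)) with hc
  have hc0 : 0 < c := by positivity
  refine bddAbove_norm_of_norm_deriv2_le (α := α) (C := (βl2 + βs2) * c)
    (w' := fun s => deriv x s - deriv z s)
    (w'' := fun s => deriv (deriv x) s - deriv (deriv z) s)
    (fun s => (hd1 hx2 s).sub (hd1 hz2 s)) (fun s => (hd2 hx2 s).sub (hd2 hz2 s))
    (by simpa using hxlim.sub hzlim) hα0 (by positivity) ?_ 0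
  filter_upwards [eventually_gt_atTop 0,
    eventually_norm_sub_smul_le (hd1 hx2) hxlim (half_pos hv0),
    eventually_norm_sub_smul_le (hd1 hz2) hzlim (half_pos hv0)] with s hs hxs hzs
  have hdecay : ∀ y ∈ Metric.closedBall (s • v) (‖v‖ / 2 * s),
      (1 + ‖y‖) ^ (-(α + 2)) ≤ c * s ^ (-(α + 2)) := fun y hy =>
    rpow_neg_one_add_norm_le (by linarith) hs hv (by rwa [← dist_eq_norm])
  have hxm : x s ∈ Metric.closedBall (s • v) (‖v‖ / 2 * s) := by
    rwa [Metric.mem_closedBall, dist_eq_norm]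
  have hzm : z s ∈ Metric.closedBall (s • v) (‖v‖ / 2 * s) := by
    rwa [Metric.mem_closedBall, dist_eq_norm]
  have hlong : ‖gradient Vl (z s) - gradient Vl (x s)‖ ≤
      βl2 * (c * s ^ (-(α + 2))) * ‖z s - x s‖ :=
    norm_gradient_sub_le hVl.1 (convex_closedBall _ _) (fun y hy =>
      (hVl.2.2.2 y).trans (mul_le_mul_of_nonneg_left (hdecay y hy) hβl2.le)) hxm hzm
  have hshort : ‖gradient Vs (x s)‖ ≤ βs2 * (c * s ^ (-(α + 2))) :=
    (hVs.2.2.1 _).trans (mul_le_mul_of_nonneg_left (hdecay _ hxm) hβs2.le)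
  have heq : deriv (deriv x) s - deriv (deriv z) s =
      (gradient Vl (z s) - gradient Vl (x s)) - gradient Vs (x s) := by
    rw [hxeq, hzeq, hF, hFl, hFl, hFs]
    abel
  rw [heq]
  refine (norm_sub_le _ _).trans ((add_le_add hlong hshort).trans ?_)
  rw [norm_sub_rev (z s), Pi.sub_apply]
  have h1 : 0 ≤ βl2 * (c * s ^ (-(α + 2))) := by positivity
  have h2 : 0 ≤ βs2 * (c * s ^ (-(α + 2))) * ‖x s - z s‖ := by positivity
  linarith

end Paper
end
end

section
/- Let v_−, x_− ∈ ℝⁿ with v_−·x_− = 0 and |v_−| ≥ μ, and let 0 < r < min(|v_−|/2^{3/2}, 1). Then for all f₁, f₂ ∈ M_r, ‖A(f₁) − A(f₂)‖ ≤ λ ‖f₁ − f₂‖, where λ := (2n/(α(|v_−|/2^{3/2} − r)(1 − r + |x_−|/√2)^α)) · (β₂ + β^s_3/(1 − r + |x_−|/√2) + β^s_3/(|v_−|/2^{3/2} − r)) · (1/(1 − r + |x_−|/√2) + 1/(|v_−|/2^{3/2} − r)). -/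
open MeasureTheory Real Filter Set Topology RealInnerProductSpace

noncomputable section

namespace Paper

variable {n : ℕ}

/-! ### Integrals of power weights -/

theorem hasDerivAt_rpow_weight {a b q t : ℝ} (hb : 0 < b) (hq : 0 < q) (ht : 0 < a - b * t) :
    HasDerivAt (fun s => (a - b * s) ^ (-q) / (b * q)) ((a - b * t) ^ (-(q + 1))) t := by
  have h₁ : HasDerivAt (fun s => a - b * s) (-b) t := by
    simpa using ((hasDerivAt_id t).const_mul b).const_sub a
  have h₂ := (h₁.rpow_const (p := -q) (Or.inl ht.ne')).div_const (b * q)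
  convert! h₂ using 1
  rw [show -q - 1 = -(q + 1) by ring]
  field_simp

theorem continuousOn_rpow_weight {a b p : ℝ} (ha : 0 < a) (hb : 0 < b) :
    ContinuousOn (fun s => (a - b * s) ^ (-p)) (Iic 0) := by
  intro s hs
  have : 0 < a - b * s := by nlinarith [mem_Iic.1 hs]
  have h : ContinuousAt (fun s => a - b * s) s := by fun_prop
  exact (h.rpow_const (Or.inl this.ne')).continuousWithinAt

theorem integrableOn_rpow_weight {a b q t : ℝ} (ha : 0 < a) (hb : 0 < b) (hq : 0 < q)
    (ht : t ≤ 0) : IntegrableOn (fun s => (a - b * s) ^ (-(q + 1))) (Iic t) := by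
  have hpos : ∀ s ≤ t, 0 < a - b * s := fun s hs => by nlinarith
  have hcont := (continuousOn_rpow_weight (p := q + 1) ha hb).mono (Iic_subset_Iic.2 ht)
  refine integrableOn_Iic_of_intervalIntegral_norm_bounded (a := id) (l := atBot)
    ((a - b * t) ^ (-q) / (b * q)) t
    (fun i => (hcont.mono Icc_subset_Iic_self).integrableOn_Icc.mono_set Ioc_subset_Icc_self)
    tendsto_id ?_
  filter_upwards [eventually_le_atBot t] with i hi
  have hI : uIcc i t ⊆ Iic t := by
    rw [uIcc_of_le hi]; exact Icc_subset_Iic_self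
  have h₁ : ∫ s in i..t, ‖(a - b * s) ^ (-(q + 1))‖ = ∫ s in i..t, (a - b * s) ^ (-(q + 1)) :=
    intervalIntegral.integral_congr fun s hs =>
      Real.norm_of_nonneg (Real.rpow_nonneg (hpos s (hI hs)).le _)
  rw [id, h₁, intervalIntegral.integral_eq_sub_of_hasDerivAt
    (fun s hs => hasDerivAt_rpow_weight hb hq (hpos s (hI hs)))
    (hcont.mono hI).intervalIntegrable]
  have := Real.rpow_nonneg (hpos i hi).le (-q)
  have : 0 ≤ (a - b * i) ^ (-q) / (b * q) := by positivity
  linarith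

theorem integral_rpow_weight {a b q t : ℝ} (ha : 0 < a) (hb : 0 < b) (hq : 0 < q) (ht : t ≤ 0) :
    ∫ s in Iic t, (a - b * s) ^ (-(q + 1)) = (a - b * t) ^ (-q) / (b * q) := by
  have hlim : Tendsto (fun s => (a - b * s) ^ (-q) / (b * q)) atBot (𝓝 0) := by
    have h₁ : Tendsto (fun s : ℝ => a - b * s) atBot atTop :=
      tendsto_atTop_add_const_left _ a
        (tendsto_neg_atBot_atTop.comp (tendsto_id.const_mul_atBot hb))
    simpa using ((tendsto_rpow_neg_atTop hq).comp h₁).div_const (b * q)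
  rw [integral_Iic_of_hasDerivAt_of_tendsto'
    (fun s hs => hasDerivAt_rpow_weight hb hq (by nlinarith [mem_Iic.1 hs]))
    (integrableOn_rpow_weight ha hb hq ht) hlim, sub_zero]

theorem rpow_weight_le {a b q t : ℝ} (ha : 0 < a) (hb : 0 < b) (hq : 0 < q) (ht : t ≤ 0) :
    (a - b * t) ^ (-q) ≤ a ^ (-q) :=
  Real.rpow_le_rpow_of_nonpos ha (by nlinarith) (by linarith)

theorem intervalIntegrable_rpow_weight_pos {a b q t : ℝ} (ha : 0 < a) (hb : 0 < b) (ht : 0 ≤ t) :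
    IntervalIntegrable (fun s => (a + b * s) ^ (-q)) volume 0 t := by
  refine ContinuousOn.intervalIntegrable fun s hs => ?_
  rw [uIcc_of_le ht] at hs
  have : 0 < a + b * s := by nlinarith [hs.1]
  have h : ContinuousAt (fun s => a + b * s) s := by fun_prop
  exact (h.rpow_const (Or.inl this.ne')).continuousWithinAt

theorem integral_rpow_weight_pos_le {a b q t : ℝ} (ha : 0 < a) (hb : 0 < b) (hq : 0 < q)
    (ht : 0 ≤ t) : ∫ s in 0..t, (a + b * s) ^ (-(q + 1)) ≤ a ^ (-q) / (b * q) := by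
  have h₁ : ∫ s in 0..t, (a + b * s) ^ (-(q + 1)) = ∫ s in -t..0, (a - b * s) ^ (-(q + 1)) := by
    have := intervalIntegral.integral_comp_neg (a := 0) (b := t)
      (fun s => (a - b * s) ^ (-(q + 1)))
    simpa using this
  have h₂ := integral_rpow_weight ha hb hq le_rfl
  rw [mul_zero, sub_zero] at h₂
  rw [h₁, ← h₂, intervalIntegral.integral_of_le (by linarith)]
  refine setIntegral_mono_set (integrableOn_rpow_weight ha hb hq le_rfl) ?_
    (Eventually.of_forall Ioc_subset_Iic_self)
  filter_upwards [ae_restrict_mem measurableSet_Iic] with s hs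
  exact Real.rpow_nonneg (by nlinarith [mem_Iic.1 hs]) _

/-! ### Iterated integrals from `-∞` -/

theorem integrableOn_Iic_of_weight {E : Type*} [NormedAddCommGroup E] {g : ℝ → E}
    {a b q C : ℝ} (ha : 0 < a) (hb : 0 < b) (hq : 0 < q) (hg : Continuous g)
    (hgb : ∀ s ≤ 0, ‖g s‖ ≤ C * (a - b * s) ^ (-(q + 1))) (t : ℝ) : IntegrableOn g (Iic t) := by
  have h₀ : IntegrableOn g (Iic 0) := by
    refine Integrable.mono' ((integrableOn_rpow_weight ha hb hq le_rfl).const_mul C)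
      hg.aestronglyMeasurable ?_
    filter_upwards [ae_restrict_mem measurableSet_Iic] with s hs using hgb s hs
  refine (h₀.union (hg.integrableOn_Icc (a := 0) (b := t))).mono_set fun s hs => ?_
  rcases le_total s 0 with h | h
  · exact Or.inl h
  · exact Or.inr ⟨h, hs⟩

section Iterated

variable {E : Type*} [NormedAddCommGroup E] [NormedSpace ℝ E] {g : ℝ → E} {a b q C : ℝ}

theorem norm_integral_Iic_le_of_weight (ha : 0 < a) (hb : 0 < b) (hq : 0 < q)
    (hgb : ∀ s ≤ 0, ‖g s‖ ≤ C * (a - b * s) ^ (-(q + 1))) {t : ℝ} (ht : t ≤ 0) :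
    ‖∫ s in Iic t, g s‖ ≤ C / (b * q) * (a - b * t) ^ (-q) := by
  refine (norm_integral_le_of_norm_le ((integrableOn_rpow_weight ha hb hq ht).const_mul C)
    ?_).trans_eq ?_
  · filter_upwards [ae_restrict_mem measurableSet_Iic] with s hs using hgb s (le_trans hs ht)
  · rw [integral_const_mul, integral_rpow_weight ha hb hq ht]; ring

theorem continuous_integral_Iic [CompleteSpace E] (hg : Continuous g)
    (hi : ∀ t, IntegrableOn g (Iic t)) :
    Continuous fun t => ∫ s in Iic t, g s := by
  have h : (fun t => ∫ s in Iic t, g s) = fun t => (∫ s in Iic 0, g s) + ∫ s in 0..t, g s := by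
    ext t
    rw [← intervalIntegral.integral_Iic_sub_Iic (hi 0) (hi t)]; abel
  rw [h]
  exact continuous_const.add
    (intervalIntegral.continuous_primitive (fun _ _ => hg.intervalIntegrable _ _) 0)

theorem integrableOn_integral_Iic_of_weight [CompleteSpace E] (ha : 0 < a) (hb : 0 < b)
    (hq : 0 < q) (hg : Continuous g)
    (hgb : ∀ s ≤ 0, ‖g s‖ ≤ C * (a - b * s) ^ (-(q + 1 + 1))) (t : ℝ) :
    IntegrableOn (fun s => ∫ τ in Iic s, g τ) (Iic t) :=
  integrableOn_Iic_of_weight ha hb hq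
    (continuous_integral_Iic hg (integrableOn_Iic_of_weight ha hb (by linarith) hg hgb))
    (fun _ hs => norm_integral_Iic_le_of_weight ha hb (by linarith) hgb hs) t

/-- Iterated integral bound on the negative half-line. -/
theorem norm_iterated_integral_le_of_nonpos (ha : 0 < a) (hb : 0 < b) (hq : 0 < q) (hC : 0 ≤ C)
    (hgb : ∀ s ≤ 0, ‖g s‖ ≤ C * (a - b * s) ^ (-(q + 1 + 1))) {t : ℝ} (ht : t ≤ 0) :
    ‖∫ s in Iic t, ∫ τ in Iic s, g τ‖ ≤ C * (a ^ (-q) / (b ^ 2 * q)) := by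
  refine (norm_integral_Iic_le_of_weight ha hb hq (C := C / (b * (q + 1)))
    (fun s hs => norm_integral_Iic_le_of_weight ha hb (by linarith) hgb hs) ht).trans ?_
  have h₁ : C / (b * (q + 1)) / (b * q) ≤ C / (b ^ 2 * q) := by
    rw [div_div]
    refine div_le_div_of_nonneg_left hC (by positivity) ?_
    nlinarith [mul_pos (mul_pos hb hq) (mul_pos hb hq), mul_pos (mul_pos hb hb) (mul_pos hq hq)]
  calc _ ≤ C / (b ^ 2 * q) * a ^ (-q) :=
        mul_le_mul h₁ (rpow_weight_le ha hb hq ht)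
          (Real.rpow_nonneg (by nlinarith) _) (by positivity)
    _ = _ := by ring

/-- Iterated integral bound on the positive half-line, for an integrand growing like `1 + t`
times the weight. -/
theorem norm_iterated_integral_le_of_nonneg [CompleteSpace E] {D : ℝ} (ha : 0 < a) (hb : 0 < b)
    (hq : 0 < q) (hC : 0 ≤ C) (hD : 0 ≤ D) (hg : Continuous g)
    (hgb : ∀ s ≤ 0, ‖g s‖ ≤ C * (a - b * s) ^ (-(q + 1 + 1)))
    (hgb' : ∀ s, 0 ≤ s → ‖g s‖ ≤ D * (1 + s) * (a + b * s) ^ (-(q + 1 + 1)))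
    {t : ℝ} (ht : 0 ≤ t) :
    ‖∫ s in Iic t, ∫ τ in Iic s, g τ‖ ≤
      (C + D) * (a ^ (-q) / (b ^ 2 * q) + a ^ (-(q + 1)) / (b * q)) * (1 + t) := by
  set P := a ^ (-q) / (b ^ 2 * q) with hP
  set Q := a ^ (-(q + 1)) / (b * q) with hQ
  have hP0 : 0 ≤ P := by positivity
  have hQ0 : 0 ≤ Q := by positivity
  have hQ' : a ^ (-(q + 1)) / (b * (q + 1)) ≤ Q :=
    div_le_div_of_nonneg_left (by positivity) (by positivity) (by nlinarith)
  have hi := integrableOn_Iic_of_weight ha hb (q := q + 1) (by linarith) hg hgb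
  have hi2 := integrableOn_integral_Iic_of_weight ha hb hq hg hgb
  have hinner : ∀ s, 0 ≤ s → ‖∫ τ in Iic s, g τ‖ ≤ (C + D) * (P + Q) := by
    intro s hs
    have h₁ : ∫ τ in Iic s, g τ = (∫ τ in Iic 0, g τ) + ∫ τ in 0..s, g τ := by
      rw [← intervalIntegral.integral_Iic_sub_Iic (hi 0) (hi s)]; abel
    have h₂ : ‖∫ τ in Iic 0, g τ‖ ≤ C * Q := by
      have := norm_integral_Iic_le_of_weight ha hb (q := q + 1) (by linarith) hgb le_rfl
      rw [mul_zero, sub_zero] at this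
      calc _ ≤ C * (a ^ (-(q + 1)) / (b * (q + 1))) := this.trans_eq (by ring)
        _ ≤ _ := by gcongr
    have h₃ : ‖∫ τ in 0..s, g τ‖ ≤ D * (Q + P) := by
      have hw₁ := intervalIntegrable_rpow_weight_pos (q := q + 1 + 1) ha hb hs
      have hw₂ := intervalIntegrable_rpow_weight_pos (q := q + 1) ha hb hs
      refine (intervalIntegral.norm_integral_le_of_norm_le hs
        (g := fun τ => D * ((a + b * τ) ^ (-(q + 1 + 1)) + b⁻¹ * (a + b * τ) ^ (-(q + 1))))
        (Eventually.of_forall fun τ hτ => (hgb' τ hτ.1.le).trans ?_)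
        ((hw₁.add (hw₂.const_mul _)).const_mul _)).trans ?_
      · have hX : 0 < a + b * τ := by nlinarith [hτ.1]
        rw [mul_assoc]
        refine mul_le_mul_of_nonneg_left ?_ hD
        have h₄ : (a + b * τ) ^ (-(q + 1)) = (a + b * τ) * (a + b * τ) ^ (-(q + 1 + 1)) := by
          rw [← Real.rpow_one_add' hX.le (by linarith)]; congr 1; ring
        have h₅ : τ ≤ b⁻¹ * (a + b * τ) := by
          rw [mul_add, inv_mul_cancel_left₀ hb.ne']
          have : 0 < b⁻¹ * a := by positivity
          linarith
        rw [h₄, ← mul_assoc, add_mul, one_mul]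
        gcongr
      · rw [intervalIntegral.integral_const_mul,
          intervalIntegral.integral_add hw₁ (hw₂.const_mul _),
          intervalIntegral.integral_const_mul]
        have h₄ := integral_rpow_weight_pos_le ha hb (q := q + 1) (by linarith) hs
        have h₅ := integral_rpow_weight_pos_le ha hb hq hs
        have h₆ : P = b⁻¹ * (a ^ (-q) / (b * q)) := by rw [hP]; field_simp
        rw [h₆]
        gcongr
        exact h₄.trans hQ'
    rw [h₁]
    refine (norm_add_le_of_le h₂ h₃).trans ?_
    nlinarith [mul_nonneg hC hP0]
  have h₁ : ∫ s in Iic t, ∫ τ in Iic s, g τ =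
      (∫ s in Iic 0, ∫ τ in Iic s, g τ) + ∫ s in 0..t, ∫ τ in Iic s, g τ := by
    rw [← intervalIntegral.integral_Iic_sub_Iic (hi2 0) (hi2 t)]; abel
  have h₂ := norm_iterated_integral_le_of_nonpos ha hb hq hC hgb le_rfl
  have h₃ : ‖∫ s in 0..t, ∫ τ in Iic s, g τ‖ ≤ (C + D) * (P + Q) * t := by
    have := intervalIntegral.norm_integral_le_of_norm_le_const (a := 0) (b := t)
      (f := fun s => ∫ τ in Iic s, g τ) (C := (C + D) * (P + Q)) fun s hs =>
        hinner s (by rw [uIoc_of_le ht] at hs; exact hs.1.le)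
    rwa [sub_zero, abs_of_nonneg ht] at this
  rw [h₁]
  refine (norm_add_le_of_le h₂ h₃).trans ?_
  nlinarith [mul_nonneg hC hQ0, mul_nonneg hD hQ0, mul_nonneg hD hP0]

end Iterated

/-! ### Lipschitz bounds for gradient fields -/

theorem continuous_gradient {V : Euc n → ℝ} (hV : ContDiff ℝ 2 V) : Continuous (gradient V) :=
  (InnerProductSpace.toDual ℝ (Euc n)).symm.continuous.comp
    (hV.continuous_fderiv (by norm_num))

theorem norm_gradient_sub_le_s3 {V : Euc n → ℝ} {B p X : ℝ} (hV : ContDiff ℝ 2 V) (hB : 0 ≤ B)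
    (hp : 0 ≤ p) (hX : 0 < X)
    (hH : ∀ x, ‖iteratedFDeriv ℝ 2 V x‖ ≤ B * (1 + ‖x‖) ^ (-p)) {s : Set (Euc n)}
    (hs : Convex ℝ s) (hsX : ∀ y ∈ s, X ≤ 1 + ‖y‖) {y₁ y₂ : Euc n} (h₁ : y₁ ∈ s) (h₂ : y₂ ∈ s) :
    ‖gradient V y₁ - gradient V y₂‖ ≤ B * X ^ (-p) * ‖y₁ - y₂‖ := by
  have hd : Differentiable ℝ (fderiv ℝ V) :=
    (hV.fderiv_right (m := 1) (by norm_num)).differentiable (by norm_num)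
  have h := hs.norm_image_sub_le_of_norm_fderiv_le (f := fderiv ℝ V) (C := B * X ^ (-p))
    (fun x _ => hd x) (fun x hx => ?_) h₂ h₁
  · rwa [gradient, gradient, ← map_sub, LinearIsometryEquiv.norm_map]
  · rw [← norm_iteratedFDeriv_one, norm_iteratedFDeriv_fderiv]
    refine (hH x).trans ?_
    gcongr B * ?_
    exact Real.rpow_le_rpow_of_nonpos hX (hsX x hx) (by linarith)

/-! ### Lower bounds on the distance to the origin -/

theorem add_div_sqrt_two_le_norm_add {E : Type*} [NormedAddCommGroup E] [InnerProductSpace ℝ E]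
    {x y : E} (h : ⟪x, y⟫ = 0) : (‖x‖ + ‖y‖) / √2 ≤ ‖x + y‖ := by
  have h₁ := norm_add_sq_eq_norm_sq_add_norm_sq_real h
  rw [div_le_iff₀ (by positivity)]
  refine abs_le_of_sq_le_sq' ?_ (by positivity) |>.2
  rw [mul_pow, Real.sq_sqrt (by norm_num)]
  nlinarith [sq_nonneg (‖x‖ - ‖y‖)]

theorem two_rpow_three_halves : (2 : ℝ) ^ ((3 : ℝ) / 2) = 2 * √2 := by
  rw [show (3 : ℝ) / 2 = 1 + 1 / 2 by norm_num, Real.rpow_add (by norm_num), Real.rpow_one,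
    Real.sqrt_eq_rpow]

theorem two_rpow_five_halves : (2 : ℝ) ^ ((5 : ℝ) / 2) = 4 * √2 := by
  rw [show (5 : ℝ) / 2 = 2 + 1 / 2 by norm_num, Real.rpow_add (by norm_num), Real.sqrt_eq_rpow]
  norm_num

theorem growth_const_le {n : ℕ} (hn : 2 ≤ n) {α β β' V : ℝ} (hα : 0 < α) (hβ : 0 < β)
    (hV : √(2 ^ 5 * (n : ℝ) * max β β' / α) ≤ V) :
    2 ^ ((5 : ℝ) / 2) * √n * β / (α * V) ≤ V / 8 := by
  have hn' : (2 : ℝ) ≤ n := by exact_mod_cast hn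
  have hmax : 0 < max β β' := lt_max_of_lt_left hβ
  have hV0 : 0 < V := lt_of_lt_of_le (Real.sqrt_pos.2 (by positivity)) hV
  have h₁ : 2 ^ 5 * (n : ℝ) * max β β' / α ≤ V ^ 2 := (Real.sqrt_le_left hV0.le).1 hV
  rw [div_le_iff₀ hα] at h₁
  have h₂ : √2 * √n ≤ n := by
    calc √2 * √n ≤ √n * √n := by gcongr
      _ = n := Real.mul_self_sqrt (by positivity)
  rw [two_rpow_five_halves, div_le_iff₀ (by positivity)]
  have h₃ : √2 * √n * β ≤ n * max β β' := mul_le_mul h₂ (le_max_left _ _) hβ.le (by positivity)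
  nlinarith

/-- A ball of radius `ρ` around `z + y` stays away from the origin when `z` is close to the
straight line `t • v` and `y` is orthogonal to `v`. -/
theorem lower_bound_of_mem_closedBall {v y z p : Euc n} {t ρ : ℝ}
    (hvy : ⟪v, y⟫ = 0) (hz : ‖z - t • v‖ ≤ ‖v‖ / 8 * |t|)
    (hp : p ∈ Metric.closedBall (z + y) ρ) :
    1 - ρ + ‖y‖ / √2 + ‖v‖ / 2 ^ ((3 : ℝ) / 2) * |t| ≤ 1 + ‖p‖ := by
  have hs : √2 ≤ 2 := by
    rw [Real.sqrt_le_left (by norm_num)]; norm_num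
  have hs0 : 0 < √2 := by positivity
  have h₁ := add_div_sqrt_two_le_norm_add (x := t • v) (y := y) (by
    rw [real_inner_smul_left, hvy, mul_zero])
  rw [norm_smul, Real.norm_eq_abs, add_div] at h₁
  have h₂ : ‖t • v + y‖ ≤ ‖p‖ + ‖p - (z + y)‖ + ‖z - t • v‖ := by
    calc ‖t • v + y‖ = ‖p - (p - (z + y)) - (z - t • v)‖ := by congr 1; abel
      _ ≤ _ := (norm_sub_le _ _).trans (by gcongr; exact norm_sub_le _ _)
  have h₃ : ‖p - (z + y)‖ ≤ ρ := by rwa [← dist_eq_norm]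
  have h₄ : ‖v‖ / 2 ^ ((3 : ℝ) / 2) * |t| + ‖v‖ / 8 * |t| ≤ |t| * ‖v‖ / √2 := by
    rw [two_rpow_three_halves]
    have h₅ : 1 / 8 ≤ 1 / (2 * √2) :=
      div_le_div_of_nonneg_left zero_le_one (by positivity) (by linarith)
    have h₆ : |t| * ‖v‖ / √2 = |t| * ‖v‖ * (1 / (2 * √2)) + |t| * ‖v‖ * (1 / (2 * √2)) := by
      field_simp; norm_num
    have h₇ : |t| * ‖v‖ * (1 / 8) ≤ |t| * ‖v‖ * (1 / (2 * √2)) := by gcongr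
    have h₈ : ‖v‖ / (2 * √2) * |t| = |t| * ‖v‖ * (1 / (2 * √2)) := by ring
    rw [h₆, h₈]
    linarith
  linarith

/-! ### The norm on `M_r` -/

theorem norm_le_sSup_neg {f : ℝ → Euc n} (h : BddAbove ((fun t => ‖f t‖) '' Iic 0)) {t : ℝ}
    (ht : t ≤ 0) : ‖f t‖ ≤ sSup ((fun t => ‖f t‖) '' Iic 0) :=
  le_csSup h ⟨t, ht, rfl⟩

theorem norm_le_sSup_pos {f : ℝ → Euc n} (h : BddAbove ((fun t => ‖f t‖ / (1 + t)) '' Ici 0))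
    {t : ℝ} (ht : 0 ≤ t) : ‖f t‖ ≤ sSup ((fun t => ‖f t‖ / (1 + t)) '' Ici 0) * (1 + t) := by
  rw [← div_le_iff₀ (by linarith)]
  exact le_csSup h ⟨t, ht, rfl⟩

theorem sSup_neg_nonneg (f : ℝ → Euc n) : 0 ≤ sSup ((fun t => ‖f t‖) '' Iic 0) := by
  apply Real.sSup_nonneg
  rintro _ ⟨t, -, rfl⟩
  exact norm_nonneg _

theorem sSup_pos_nonneg (f : ℝ → Euc n) : 0 ≤ sSup ((fun t => ‖f t‖ / (1 + t)) '' Ici 0) := by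
  apply Real.sSup_nonneg
  rintro _ ⟨t, ht, rfl⟩
  have : (0 : ℝ) ≤ t := ht
  positivity

theorem MemM.norm_le_neg {r : ℝ} {f : ℝ → Euc n} (h : MemM r f) {t : ℝ} (ht : t ≤ 0) :
    ‖f t‖ ≤ r :=
  (norm_le_sSup_neg h.2.1 ht).trans
    ((le_add_of_nonneg_right (sSup_pos_nonneg f)).trans h.2.2.2)

theorem MemM.norm_le_pos {r : ℝ} {f : ℝ → Euc n} (h : MemM r f) {t : ℝ} (ht : 0 ≤ t) :
    ‖f t‖ ≤ r * (1 + t) := by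
  refine (norm_le_sSup_pos h.2.2.1 ht).trans ?_
  gcongr
  exact (le_add_of_nonneg_left (sSup_neg_nonneg f)).trans h.2.2.2

theorem MemM.bddAbove_sub_neg {r : ℝ} {f₁ f₂ : ℝ → Euc n} (h₁ : MemM r f₁) (h₂ : MemM r f₂) :
    BddAbove ((fun t => ‖f₁ t - f₂ t‖) '' Iic 0) := by
  refine ⟨r + r, ?_⟩
  rintro _ ⟨t, ht, rfl⟩
  exact norm_sub_le_of_le (h₁.norm_le_neg ht) (h₂.norm_le_neg ht)

theorem MemM.bddAbove_sub_pos {r : ℝ} {f₁ f₂ : ℝ → Euc n} (h₁ : MemM r f₁) (h₂ : MemM r f₂) :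
    BddAbove ((fun t => ‖f₁ t - f₂ t‖ / (1 + t)) '' Ici 0) := by
  refine ⟨r + r, ?_⟩
  rintro _ ⟨t, ht, rfl⟩
  have ht : (0 : ℝ) ≤ t := ht
  rw [div_le_iff₀ (by linarith), add_mul]
  exact norm_sub_le_of_le (h₁.norm_le_pos ht) (h₂.norm_le_pos ht)

theorem Mnorm_le {f : ℝ → Euc n} {c d : ℝ} (hc : ∀ t ≤ 0, ‖f t‖ ≤ c)
    (hd : ∀ t, 0 ≤ t → ‖f t‖ ≤ d * (1 + t)) : Mnorm f ≤ c + d := by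
  refine add_le_add (csSup_le (nonempty_Iic.image _) ?_) (csSup_le (nonempty_Ici.image _) ?_)
  · rintro _ ⟨t, ht, rfl⟩
    exact hc t ht
  · rintro _ ⟨t, ht, rfl⟩
    have ht : (0 : ℝ) ≤ t := ht
    exact (div_le_iff₀ (by linarith)).2 (hd t ht)

/-! ### The contraction estimate -/

/-- Lipschitz bound for the total force on a convex set away from the origin. -/
theorem norm_force_sub_le {α βl0 βl1 βl2 βs1 βs2 βs3 a X : ℝ} {Vl Vs : Euc n → ℝ}
    {Fl Fs F : Euc n → Euc n} (hα : 0 < α) (hβl2 : 0 < βl2) (hβs3 : 0 < βs3)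
    (hVl : LongRange α βl0 βl1 βl2 Vl) (hVs : ShortRange α βs1 βs2 βs3 Vs)
    (hFl : ∀ y, Fl y = -gradient Vl y) (hFs : ∀ y, Fs y = -gradient Vs y)
    (hF : ∀ y, F y = Fl y + Fs y) (ha : 0 < a) (haX : a ≤ X) {s : Set (Euc n)}
    (hs : Convex ℝ s) (hsX : ∀ y ∈ s, X ≤ 1 + ‖y‖) {y₁ y₂ : Euc n} (h₁ : y₁ ∈ s) (h₂ : y₂ ∈ s) :
    ‖F y₁ - F y₂‖ ≤ (βl2 + βs3 / a) * X ^ (-(α + 1 + 1)) * ‖y₁ - y₂‖ := by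
  have hX := ha.trans_le haX
  have hl := norm_gradient_sub_le_s3 hVl.1 hβl2.le (by linarith) hX hVl.2.2.2 hs hsX h₁ h₂
  have hs := norm_gradient_sub_le_s3 hVs.1 hβs3.le (by linarith) hX hVs.2.2.2 hs hsX h₁ h₂
  have hp : X ^ (-(α + 3)) ≤ a⁻¹ * X ^ (-(α + 2)) := by
    rw [show -(α + 3) = -1 + -(α + 2) by ring, Real.rpow_add hX, Real.rpow_neg_one]
    gcongr
  have he : F y₁ - F y₂ =
      -(gradient Vl y₁ - gradient Vl y₂) - (gradient Vs y₁ - gradient Vs y₂) := by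
    simp only [hF, hFl, hFs]; abel
  rw [he, show α + 1 + 1 = α + 2 by ring]
  refine (norm_sub_le _ _).trans ?_
  rw [norm_neg]
  calc _ ≤ βl2 * X ^ (-(α + 2)) * ‖y₁ - y₂‖
        + βs3 * (a⁻¹ * X ^ (-(α + 2))) * ‖y₁ - y₂‖ := by
        refine add_le_add hl (hs.trans ?_)
        gcongr
    _ = _ := by ring

/-- The contraction constant dominates the one produced by the integral bounds. -/
theorem two_mul_integral_const_le {n : ℕ} (hn : 1 ≤ n) {α a b β γ B : ℝ} (hα : 0 < α)
    (ha : 0 < a) (hb : 0 < b) (hβ : 0 ≤ β) (hγ : 0 ≤ γ) (hB : β ≤ B) :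
    2 * ((β + γ / a) * (a ^ (-α) / (b ^ 2 * α) + a ^ (-(α + 1)) / (b * α))) ≤
      2 * (n : ℝ) / (α * b * a ^ α) * (B + γ / a + γ / b) * (1 / a + 1 / b) := by
  have hn' : (1 : ℝ) ≤ n := by exact_mod_cast hn
  have hpow : 0 < a ^ α := by positivity
  have h₁ : a ^ (-α) / (b ^ 2 * α) + a ^ (-(α + 1)) / (b * α) =
      1 / (α * b * a ^ α) * (1 / a + 1 / b) := by
    rw [Real.rpow_neg ha.le, Real.rpow_neg ha.le, Real.rpow_add ha, Real.rpow_one]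
    field_simp
    ring
  have h₂ : β + γ / a ≤ B + γ / a + γ / b := by
    have : 0 ≤ γ / b := by positivity
    linarith
  rw [h₁]
  calc _ = 2 * 1 / (α * b * a ^ α) * (β + γ / a) * (1 / a + 1 / b) := by ring
    _ ≤ _ := by gcongr

/-- The integrand defining `Aop` is dominated by an integrable power weight near `-∞`. -/
theorem norm_force_sub_free_le {α βl0 βl1 βl2 βs1 βs2 βs3 r b : ℝ} {Vl Vs : Euc n → ℝ}
    {Fl Fs F : Euc n → Euc n} (hα : 0 < α) (hβl2 : 0 < βl2) (hβs2 : 0 < βs2)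
    (hVl : LongRange α βl0 βl1 βl2 Vl) (hVs : ShortRange α βs1 βs2 βs3 Vs)
    (hFl : ∀ y, Fl y = -gradient Vl y) (hFs : ∀ y, Fs y = -gradient Vs y)
    (hF : ∀ y, F y = Fl y + Fs y) {v x z y : Euc n} {t : ℝ} (ht : t ≤ 0)
    (hr1 : r < 1) (hr0 : 0 ≤ r) (hb : 0 < b) (hbv : b ≤ ‖v‖ / 2 ^ ((3 : ℝ) / 2))
    (hvx : ⟪v, x⟫ = 0) (hz : ‖z - t • v‖ ≤ ‖v‖ / 8 * |t|) (hy : ‖y‖ ≤ r) :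
    ‖F (z + x + y) - Fl z‖ ≤
      (βl2 * (r + ‖x‖) + βs2) * (1 - r - b * t) ^ (-(α + 1 + 1)) := by
  set X := 1 - r - b * t with hXdef
  have hX : 0 < X := by nlinarith
  have hbt : b * -t ≤ ‖v‖ / 2 ^ ((3 : ℝ) / 2) * |t| := by
    rw [abs_of_nonpos ht]
    exact mul_le_mul_of_nonneg_right hbv (by linarith)
  have hball : ∀ w, ⟪v, w⟫ = 0 → ∀ p ∈ Metric.closedBall (z + w) r, X ≤ 1 + ‖p‖ := by
    intro w hw p hp
    have := lower_bound_of_mem_closedBall hw hz hp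
    have : 0 ≤ ‖w‖ / √2 := by positivity
    linarith
  have hmem : z + x + y ∈ Metric.closedBall (z + x) r := by simpa [dist_eq_norm] using hy
  have hlip {s : Set (Euc n)} (hs : Convex ℝ s) (hsX : ∀ y ∈ s, X ≤ 1 + ‖y‖) {y₁ y₂ : Euc n} :=
    norm_gradient_sub_le_s3 (y₁ := y₁) (y₂ := y₂) hVl.1 hβl2.le (by linarith) hX hVl.2.2.2 hs hsX
  have h₁ := hlip (convex_closedBall (z + x) r) (hball x hvx) hmem
    (Metric.mem_closedBall_self hr0)
  have h₂ := hlip (convex_segment z (z + x)) (fun p hp => by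
    obtain ⟨θ, -, rfl⟩ := (segment_eq_image' ℝ z (z + x)).subset hp
    refine hball (θ • x) (by rw [real_inner_smul_right, hvx, mul_zero]) _ ?_
    simpa using hr0) (right_mem_segment ℝ z (z + x)) (left_mem_segment ℝ z (z + x))
  have h₃ : ‖gradient Vs (z + x + y)‖ ≤ βs2 * X ^ (-(α + 2)) := by
    refine (hVs.2.2.1 _).trans ?_
    gcongr βs2 * ?_
    exact Real.rpow_le_rpow_of_nonpos hX (hball x hvx _ hmem) (by linarith)
  rw [add_sub_cancel_left] at h₁ h₂
  have he : F (z + x + y) - Fl z = -(gradient Vl (z + x + y) - gradient Vl (z + x))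
      - (gradient Vl (z + x) - gradient Vl z) - gradient Vs (z + x + y) := by
    simp only [hF, hFl, hFs]; abel
  rw [he, show α + 1 + 1 = α + 2 by ring]
  refine (norm_sub_le_of_le (norm_sub_le_of_le ((norm_neg _).trans_le h₁) h₂) h₃).trans ?_
  have hw : 0 ≤ βl2 * X ^ (-(α + 2)) := by positivity
  nlinarith [mul_le_mul_of_nonneg_left hy hw]

/-- `Aop` turns a weighted bound on the difference of the integrands into an `Mnorm` bound. -/
theorem Mnorm_iterated_integral_sub_le {g₁ g₂ : ℝ → Euc n} {a a' b q C K D₁ D₂ : ℝ}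
    (ha : 0 < a) (ha' : 0 < a') (hb : 0 < b) (hq : 0 < q) (hK : 0 ≤ K) (hD₁ : 0 ≤ D₁)
    (hD₂ : 0 ≤ D₂) (hg₁ : Continuous g₁) (hg₂ : Continuous g₂)
    (hgb₁ : ∀ s ≤ 0, ‖g₁ s‖ ≤ C * (a' - b * s) ^ (-(q + 1 + 1)))
    (hgb₂ : ∀ s ≤ 0, ‖g₂ s‖ ≤ C * (a' - b * s) ^ (-(q + 1 + 1)))
    (hneg : ∀ s ≤ 0, ‖g₁ s - g₂ s‖ ≤ K * D₁ * (a - b * s) ^ (-(q + 1 + 1)))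
    (hpos : ∀ s, 0 ≤ s → ‖g₁ s - g₂ s‖ ≤ K * D₂ * (1 + s) * (a + b * s) ^ (-(q + 1 + 1))) :
    Mnorm (fun t => (∫ s in Iic t, ∫ τ in Iic s, g₁ τ) - ∫ s in Iic t, ∫ τ in Iic s, g₂ τ) ≤
      2 * (K * (a ^ (-q) / (b ^ 2 * q) + a ^ (-(q + 1)) / (b * q))) * (D₁ + D₂) := by
  have he : ∀ t, (∫ s in Iic t, ∫ τ in Iic s, g₁ τ) - ∫ s in Iic t, ∫ τ in Iic s, g₂ τ =
      ∫ s in Iic t, ∫ τ in Iic s, (g₁ τ - g₂ τ) := by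
    intro t
    rw [← integral_sub (integrableOn_integral_Iic_of_weight ha' hb hq hg₁ hgb₁ t)
      (integrableOn_integral_Iic_of_weight ha' hb hq hg₂ hgb₂ t)]
    refine integral_congr_ae (Eventually.of_forall fun s => ?_)
    exact (integral_sub (integrableOn_Iic_of_weight ha' hb (by linarith) hg₁ hgb₁ s)
      (integrableOn_Iic_of_weight ha' hb (by linarith) hg₂ hgb₂ s)).symm
  simp only [he]
  set P := a ^ (-q) / (b ^ 2 * q)
  set Q := a ^ (-(q + 1)) / (b * q)
  have hP0 : 0 ≤ P := by positivity
  have hQ0 : 0 ≤ Q := by positivity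
  refine (Mnorm_le
    (fun t ht => norm_iterated_integral_le_of_nonpos ha hb hq (by positivity) hneg ht)
    (fun t ht => norm_iterated_integral_le_of_nonneg ha hb hq (by positivity) (by positivity)
      (hg₁.sub hg₂) hneg hpos ht)).trans ?_
  have h₁ : K * D₁ * P ≤ K * (D₁ + D₂) * (P + Q) := by
    gcongr <;> linarith
  linarith

theorem statement_3
    (n : ℕ) (hn : 2 ≤ n) (α : ℝ) (hα0 : 0 < α) (hα1 : α ≤ 1)
    (Vl Vs : Euc n → ℝ) (βl0 βl1 βl2 βs1 βs2 βs3 : ℝ)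
    (hβl0 : 0 < βl0) (hβl1 : 0 < βl1) (hβl2 : 0 < βl2)
    (hβs1 : 0 < βs1) (hβs2 : 0 < βs2) (hβs3 : 0 < βs3)
    (hVl : LongRange α βl0 βl1 βl2 Vl) (hVs : ShortRange α βs1 βs2 βs3 Vs)
    (Fl Fs F : Euc n → Euc n)
    (hFl : ∀ y, Fl y = -gradient Vl y) (hFs : ∀ y, Fs y = -gradient Vs y)
    (hF : ∀ y, F y = Fl y + Fs y)
    (vm xm : Euc n) (hperp : ⟪vm, xm⟫ = 0) (hvm : Real.sqrt (2 ^ 5 * (n : ℝ) * max βl1 βl2 / α) ≤ ‖vm‖)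
    (zm : ℝ → Euc n) (hzm : IsFreeSol Fl 0 vm atBot (2 ^ ((5:ℝ)/2) * Real.sqrt n * βl1 / (α * ‖vm‖)) zm)
    (r : ℝ) (hr0 : 0 < r) (hr : r < min (‖vm‖ / 2 ^ ((3:ℝ)/2)) 1)
 :
    ∀ f₁ f₂ : ℝ → Euc n, MemM r f₁ → MemM r f₂ →
      Mnorm (fun t => Aop Fl F zm xm f₁ t - Aop Fl F zm xm f₂ t) ≤
        (2 * (n : ℝ) /
            (α * (‖vm‖ / 2 ^ ((3:ℝ)/2) - r) * (1 - r + ‖xm‖ / Real.sqrt 2) ^ α) *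
          (max βl2 βs2 + βs3 / (1 - r + ‖xm‖ / Real.sqrt 2) + βs3 / (‖vm‖ / 2 ^ ((3:ℝ)/2) - r)) *
          (1 / (1 - r + ‖xm‖ / Real.sqrt 2) + 1 / (‖vm‖ / 2 ^ ((3:ℝ)/2) - r))) * Mnorm (fun t => f₁ t - f₂ t) := by
  intro f₁ f₂ hf₁ hf₂
  obtain ⟨hrv, hr1⟩ := lt_min_iff.1 hr
  set b := ‖vm‖ / 2 ^ ((3 : ℝ) / 2) - r with hbdef
  set a := 1 - r + ‖xm‖ / √2 with hadef
  have hb : 0 < b := sub_pos.2 hrv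
  have hx0 : 0 ≤ ‖xm‖ / √2 := by positivity
  have ha : 0 < a := by linarith
  have hz : ∀ t, ‖zm t - t • vm‖ ≤ ‖vm‖ / 8 * |t| := by
    intro t
    have h := hzm.2.2.2.2 t
    rw [sub_zero] at h
    exact h.trans (mul_le_mul_of_nonneg_right (growth_const_le hn hα0 hβl1 hvm) (abs_nonneg t))
  have hFl' : Continuous Fl := by
    rw [funext hFl]; exact (continuous_gradient hVl.1).neg
  have hF' : Continuous F := by
    rw [funext hF]
    refine hFl'.add ?_
    rw [funext hFs]; exact (continuous_gradient hVs.1).neg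
  have hzc : Continuous zm := hzm.1.continuous
  have hcont : ∀ f : ℝ → Euc n, Continuous f →
      Continuous fun τ => F (zm τ + xm + f τ) - Fl (zm τ) := by
    intro f hf; fun_prop
  have hfree : ∀ f : ℝ → Euc n, MemM r f → ∀ s ≤ 0, ‖F (zm s + xm + f s) - Fl (zm s)‖ ≤
      (βl2 * (r + ‖xm‖) + βs2) * (1 - r - b * s) ^ (-(α + 1 + 1)) := fun f hf s hs =>
    norm_force_sub_free_le hα0 hβl2 hβs2 hVl hVs hFl hFs hF hs hr1 hr0.le hb (by linarith)
      hperp (hz s) (hf.norm_le_neg hs)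
  have hlip : ∀ s ρ X : ℝ, a ≤ X →
      X ≤ 1 - ρ + ‖xm‖ / √2 + ‖vm‖ / 2 ^ ((3 : ℝ) / 2) * |s| → ‖f₁ s‖ ≤ ρ → ‖f₂ s‖ ≤ ρ →
      ‖F (zm s + xm + f₁ s) - Fl (zm s) - (F (zm s + xm + f₂ s) - Fl (zm s))‖ ≤
        (βl2 + βs3 / a) * X ^ (-(α + 1 + 1)) * ‖f₁ s - f₂ s‖ := by
    intro s ρ X haX hX h₁ h₂
    have h := norm_force_sub_le hα0 hβl2 hβs3 hVl hVs hFl hFs hF ha haX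
      (convex_closedBall (zm s + xm) ρ)
      (fun p hp => hX.trans (lower_bound_of_mem_closedBall hperp (hz s) hp))
      (y₁ := zm s + xm + f₁ s) (y₂ := zm s + xm + f₂ s)
      (by simpa [dist_eq_norm] using h₁) (by simpa [dist_eq_norm] using h₂)
    rw [add_sub_add_left_eq_sub] at h
    rwa [sub_sub_sub_cancel_right]
  have hmain := Mnorm_iterated_integral_sub_le ha (sub_pos.2 hr1) hb hα0
    (K := βl2 + βs3 / a) (by positivity)
    (sSup_neg_nonneg fun t => f₁ t - f₂ t) (sSup_pos_nonneg fun t => f₁ t - f₂ t)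
    (hcont f₁ hf₁.1) (hcont f₂ hf₂.1) (hfree f₁ hf₁) (hfree f₂ hf₂)
    (fun s hs => by
      refine (hlip s r (a - b * s) (by nlinarith) ?_ (hf₁.norm_le_neg hs)
        (hf₂.norm_le_neg hs)).trans ?_
      · rw [abs_of_nonpos hs, hadef, hbdef]
        nlinarith
      · have hX : 0 ≤ a - b * s := by nlinarith
        rw [mul_right_comm]
        gcongr
        exact norm_le_sSup_neg (f := fun t => f₁ t - f₂ t) (hf₁.bddAbove_sub_neg hf₂) hs)
    (fun s hs => by
      refine (hlip s (r * (1 + s)) (a + b * s) (by nlinarith) ?_ (hf₁.norm_le_pos hs)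
        (hf₂.norm_le_pos hs)).trans ?_
      · rw [abs_of_nonneg hs, hadef, hbdef]
        linarith
      · have hX : 0 ≤ a + b * s := by nlinarith
        rw [mul_right_comm, mul_assoc (βl2 + βs3 / a) _ (1 + s)]
        gcongr
        exact norm_le_sSup_pos (f := fun t => f₁ t - f₂ t) (hf₁.bddAbove_sub_pos hf₂) hs)
  refine hmain.trans (mul_le_mul_of_nonneg_right ?_
    (add_nonneg (sSup_neg_nonneg _) (sSup_pos_nonneg _)))
  exact two_mul_integral_const_le (by linarith) hα0 ha hb hβl2.le hβs3.le (le_max_left _ _)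

end Paper
end
end
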